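/- For the Sherrington–Kirkpatrick model, for every β > 0 the thermodynamic limit of the quenched free energy per site exists: lim_{N→∞} α_N(β)/(βN) = inf_{N≥1} α_N(β)/(βN); equivalently, F_N(β) = −(1/(βN)) E[log Z_N(β)] converges as N → ∞ to inf_{N≥1} F_N(β). -/

import Mathlib

open MeasureTheory ProbabilityTheory

/-- The law of the i.i.d. standard Gaussian couplings `(J_{ij})_{1 ≤ i,j ≤ N}`. -/
noncomputable def skCouplings (N : ℕ) : Measure (Fin N → Fin N → ℝ) :=
  Measure.pi fun _ => Measure.pi fun _ => gaussianReal 0 1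

/-- The Sherrington–Kirkpatrick Hamiltonian
`H_N(σ) = −(1/√N) Σ_{i,j} J_{ij} σ(i) σ(j)`, with configurations `σ ∈ {−1,1}^N`
encoded as `σ : Fin N → Bool` (where `true ↦ 1`, `false ↦ −1`). -/
noncomputable def skH (N : ℕ) (J : Fin N → Fin N → ℝ) (σ : Fin N → Bool) : ℝ :=
  -(1 / Real.sqrt N) * ∑ i, ∑ j,
    J i j * (if σ i then (1 : ℝ) else -1) * (if σ j then (1 : ℝ) else -1)

/-- The partition function `Z_N(β) = Σ_σ exp(−β H_N(σ))`. -/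
noncomputable def skZ (N : ℕ) (β : ℝ) (J : Fin N → Fin N → ℝ) : ℝ :=
  ∑ σ : Fin N → Bool, Real.exp (-β * skH N J σ)

/-- `α_N(β) = −E[log Z_N(β)]`. -/
noncomputable def skAlpha (N : ℕ) (β : ℝ) : ℝ :=
  -∫ J, Real.log (skZ N β J) ∂(skCouplings N)

/-- Gaussian integration by parts on the real line. -/
lemma integral_id_mul_gaussianReal {f f' : ℝ → ℝ} {B B' : ℝ}
    (hf : ∀ x, HasDerivAt f (f' x) x) (hf' : Continuous f')
    (hB : ∀ x, ‖f x‖ ≤ B) (hB' : ∀ x, ‖f' x‖ ≤ B') :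
    ∫ x, x * f x ∂gaussianReal 0 1 = ∫ x, f' x ∂gaussianReal 0 1 := by
  have hfc : Continuous f := continuous_iff_continuousAt.2 fun x => (hf x).continuousAt
  have hd : ∀ x, HasDerivAt (gaussianPDFReal 0 1) (-x * gaussianPDFReal 0 1 x) x := by
    intro x
    have h := (((hasDerivAt_pow 2 x).neg.div_const 2).exp).const_mul (√(2 * Real.pi))⁻¹
    refine (h.congr_of_eventuallyEq (.of_forall fun y => ?_)).congr_deriv ?_
    · simp [gaussianPDFReal]
    · simp [gaussianPDFReal]; ring
  have hp : Integrable (gaussianPDFReal 0 1) := integrable_gaussianPDFReal 0 1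
  have hxp : Integrable (fun x => -x * gaussianPDFReal 0 1 x) := by
    have h := (integrable_mul_exp_neg_mul_sq (b := 1 / 2) (by norm_num)).const_mul
      (-(√(2 * Real.pi))⁻¹)
    refine h.congr (.of_forall fun x => ?_)
    simp only [gaussianPDFReal, sub_zero, NNReal.coe_one, mul_one]
    rw [show -x ^ 2 / 2 = -(1 / 2) * x ^ 2 by ring]
    ring
  have key := integral_mul_deriv_eq_deriv_mul_of_integrable (u := f) (u' := f')
    (v := gaussianPDFReal 0 1) (v' := fun x => -x * gaussianPDFReal 0 1 x)
    (fun x _ => hf x) (fun x _ => hd x)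
    (hxp.bdd_mul hfc.aestronglyMeasurable (.of_forall hB))
    (hp.bdd_mul hf'.aestronglyMeasurable (.of_forall hB'))
    (hp.bdd_mul hfc.aestronglyMeasurable (.of_forall hB))
  rw [integral_gaussianReal_eq_integral_smul one_ne_zero,
    integral_gaussianReal_eq_integral_smul one_ne_zero, ← neg_inj]
  simp only [smul_eq_mul, mul_comm (gaussianPDFReal 0 1 _) (f' _)]
  rw [← key, ← integral_neg]
  congr 1 with x
  ring

/-- Resampling one coordinate preserves a product probability measure. -/
lemma measurePreserving_update {K : Type*} [Fintype K] [DecidableEq K] {X : Type*}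
    [MeasurableSpace X] (μ : Measure X) [IsProbabilityMeasure μ] (k : K) :
    MeasurePreserving (fun p : (K → X) × X => Function.update p.1 k p.2)
      ((Measure.pi fun _ => μ).prod μ) (Measure.pi fun _ => μ) := by
  have hm : Measurable (fun p : (K → X) × X => Function.update p.1 k p.2) := by
    refine measurable_pi_lambda _ fun j => ?_
    by_cases h : j = k
    · subst h; simpa using measurable_snd
    · simp only [Function.update_of_ne h]; fun_prop
  refine ⟨hm, (Measure.pi_eq fun s hs => ?_).symm⟩
  rw [Measure.map_apply hm (.univ_pi hs)]
  have : (fun p : (K → X) × X => Function.update p.1 k p.2) ⁻¹' Set.univ.pi s =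
      (Set.univ.pi (Function.update s k Set.univ)) ×ˢ s k := by
    ext p
    simp only [Set.mem_preimage, Set.mem_pi, Set.mem_univ, true_imp_iff, Set.mem_prod]
    refine ⟨fun h => ⟨fun j => ?_, by simpa using h k⟩, fun h j => ?_⟩
    · by_cases hj : j = k
      · subst hj; simp
      · simpa [hj] using h j
    · by_cases hj : j = k
      · subst hj; simpa using h.2
      · simpa [hj] using h.1 j
  rw [this, Measure.prod_prod, Measure.pi_pi, ← Finset.mul_prod_erase _ _ (Finset.mem_univ k),
    ← Finset.mul_prod_erase Finset.univ (fun i => μ (s i)) (Finset.mem_univ k)]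
  simp only [Function.update_self, measure_univ, one_mul]
  rw [mul_comm]
  congr 1
  refine Finset.prod_congr rfl fun j hj => ?_
  rw [Function.update_of_ne (Finset.ne_of_mem_erase hj)]

/-- The standard Gaussian measure on `K → ℝ`. -/
noncomputable abbrev stdGaussianPi (K : Type*) [Fintype K] : Measure (K → ℝ) :=
  Measure.pi fun _ => gaussianReal 0 1

lemma integrable_eval_stdGaussianPi {K : Type*} [Fintype K] (k : K) :
    Integrable (fun g : K → ℝ => g k) (stdGaussianPi K) :=
  integrable_comp_eval (μ := fun _ : K => gaussianReal 0 1) (f := fun x : ℝ => x)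
    ((memLp_id_gaussianReal 1).integrable le_rfl)

/-- Gaussian integration by parts in the coordinate `k`. -/
lemma integral_eval_mul_stdGaussianPi {K : Type*} [Fintype K] [DecidableEq K] (k : K)
    {f f' : (K → ℝ) → ℝ} {B B' : ℝ} (hfc : Continuous f) (hfc' : Continuous f')
    (hf : ∀ g t, HasDerivAt (fun t => f (Function.update g k t)) (f' (Function.update g k t)) t)
    (hB : ∀ g, ‖f g‖ ≤ B) (hB' : ∀ g, ‖f' g‖ ≤ B') :
    ∫ g, g k * f g ∂stdGaussianPi K = ∫ g, f' g ∂stdGaussianPi K := by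
  have hmp := measurePreserving_update (gaussianReal 0 1) k
  have hi : Integrable (fun g : K → ℝ => g k * f g) (stdGaussianPi K) :=
    (integrable_eval_stdGaussianPi k).mul_bdd hfc.aestronglyMeasurable (.of_forall hB)
  have hi' : Integrable f' (stdGaussianPi K) :=
    Integrable.of_bound hfc'.aestronglyMeasurable B' (.of_forall hB')
  have e : ∀ F : (K → ℝ) → ℝ, Integrable F (stdGaussianPi K) →
      ∫ g, F g ∂stdGaussianPi K =
        ∫ g, ∫ t, F (Function.update g k t) ∂gaussianReal 0 1 ∂stdGaussianPi K := by
    intro F hF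
    have hF' := hmp.integrable_comp_of_integrable hF
    have h := integral_map hmp.measurable.aemeasurable (f := F)
      (by rw [hmp.map_eq]; exact hF.aestronglyMeasurable)
    rw [hmp.map_eq] at h
    exact h.trans (integral_prod _ hF')
  rw [e _ hi, e _ hi']
  congr 1 with g
  simp only [Function.update_self]
  exact integral_id_mul_gaussianReal (hf g) (hfc'.comp (by fun_prop)) (fun _ => hB _)
    (fun _ => hB' _)

/-- Gibbs weights `exp (x σ) / ∑ τ, exp (x τ)`. -/
noncomputable def gibbsWeight {S : Type*} [Fintype S] (x : S → ℝ) (σ : S) : ℝ :=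
  Real.exp (x σ) / ∑ τ, Real.exp (x τ)

section Gibbs

variable {S : Type*} [Fintype S] [Nonempty S]

lemma sum_exp_pos (x : S → ℝ) : 0 < ∑ τ, Real.exp (x τ) :=
  Finset.sum_pos (fun _ _ => Real.exp_pos _) Finset.univ_nonempty

lemma gibbsWeight_nonneg (x : S → ℝ) (σ : S) : 0 ≤ gibbsWeight x σ :=
  div_nonneg (Real.exp_pos _).le (sum_exp_pos x).le

lemma gibbsWeight_le_one (x : S → ℝ) (σ : S) : gibbsWeight x σ ≤ 1 :=
  div_le_one_of_le₀ (Finset.single_le_sum (f := fun τ => Real.exp (x τ))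
    (fun _ _ => (Real.exp_pos _).le) (Finset.mem_univ σ)) (sum_exp_pos x).le

lemma norm_gibbsWeight_le_one (x : S → ℝ) (σ : S) : ‖gibbsWeight x σ‖ ≤ 1 := by
  rw [Real.norm_of_nonneg (gibbsWeight_nonneg x σ)]
  exact gibbsWeight_le_one x σ

@[fun_prop]
lemma continuous_gibbsWeight (σ : S) : Continuous fun x : S → ℝ => gibbsWeight x σ :=
  Continuous.div (by fun_prop) (by fun_prop) fun x => (sum_exp_pos x).ne'

@[fun_prop]
lemma continuous_log_sum_exp : Continuous fun x : S → ℝ => Real.log (∑ τ, Real.exp (x τ)) :=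
  Continuous.log (by fun_prop) fun x => (sum_exp_pos x).ne'

lemma hasDerivAt_log_sum_exp {x : ℝ → S → ℝ} {x' : S → ℝ} {t : ℝ}
    (h : ∀ σ, HasDerivAt (fun t => x t σ) (x' σ) t) :
    HasDerivAt (fun t => Real.log (∑ τ, Real.exp (x t τ)))
      (∑ σ, gibbsWeight (x t) σ * x' σ) t := by
  refine ((HasDerivAt.fun_sum fun τ _ => (h τ).exp).log (sum_exp_pos _).ne').congr_deriv ?_
  simp only [gibbsWeight, Finset.sum_div]
  exact Finset.sum_congr rfl fun σ _ => by ring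

lemma hasDerivAt_gibbsWeight {x : ℝ → S → ℝ} {x' : S → ℝ} {t : ℝ}
    (h : ∀ σ, HasDerivAt (fun t => x t σ) (x' σ) t) (σ : S) :
    HasDerivAt (fun t => gibbsWeight (x t) σ)
      (gibbsWeight (x t) σ * (x' σ - ∑ τ, gibbsWeight (x t) τ * x' τ)) t := by
  have hz := (sum_exp_pos (x t)).ne'
  refine ((h σ).exp.div (HasDerivAt.fun_sum fun τ _ => (h τ).exp) hz).congr_deriv ?_
  have : ∑ τ, gibbsWeight (x t) τ * x' τ =
      (∑ τ, Real.exp (x t τ) * x' τ) / ∑ τ, Real.exp (x t τ) := by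
    rw [Finset.sum_div]
    exact Finset.sum_congr rfl fun σ _ => by simp only [gibbsWeight]; ring
  rw [this, gibbsWeight]
  field_simp

lemma abs_log_sum_exp_le (x : S → ℝ) :
    |Real.log (∑ τ, Real.exp (x τ))| ≤ Real.log (Fintype.card S) + ∑ τ, |x τ| := by
  obtain ⟨σ₀⟩ := ‹Nonempty S›
  have hle : ∀ σ, |x σ| ≤ ∑ τ, |x τ| := fun σ =>
    Finset.single_le_sum (f := fun τ => |x τ|) (fun _ _ => abs_nonneg _) (Finset.mem_univ σ)
  have hcard : (1 : ℝ) ≤ Fintype.card S := by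
    exact_mod_cast Fintype.card_pos
  have hlog := Real.log_nonneg hcard
  rw [abs_le]
  constructor
  · have h1 : Real.exp (x σ₀) ≤ ∑ τ, Real.exp (x τ) :=
      Finset.single_le_sum (f := fun τ => Real.exp (x τ))
        (fun _ _ => (Real.exp_pos _).le) (Finset.mem_univ σ₀)
    have h2 := Real.log_le_log (Real.exp_pos _) h1
    rw [Real.log_exp] at h2
    linarith [hle σ₀, neg_abs_le (x σ₀)]
  · have h1 : ∑ τ, Real.exp (x τ) ≤ Fintype.card S * Real.exp (∑ τ, |x τ|) := by
      refine (Finset.sum_le_sum fun τ _ =>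
        Real.exp_le_exp.2 ((le_abs_self _).trans (hle τ))).trans ?_
      simp
    have h2 := Real.log_le_log (sum_exp_pos x) h1
    rwa [Real.log_mul (by positivity) (Real.exp_pos _).ne', Real.log_exp] at h2

end Gibbs

section Comparison

variable {S K : Type*} [Fintype S] [Nonempty S] [Fintype K]

@[fun_prop]
lemma continuous_gibbsWeight_linear (c : S → K → ℝ) (σ : S) :
    Continuous fun g : K → ℝ => gibbsWeight (fun τ => ∑ k, c τ k * g k) σ :=
  (continuous_gibbsWeight σ).comp (f := fun (g : K → ℝ) τ => ∑ k, c τ k * g k) (by fun_prop)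

lemma integrable_log_sum_exp_stdGaussianPi (c : S → K → ℝ) :
    Integrable (fun g : K → ℝ => Real.log (∑ σ, Real.exp (∑ k, c σ k * g k)))
      (stdGaussianPi K) := by
  have hi : Integrable (fun g : K → ℝ =>
      Real.log (Fintype.card S) + ∑ σ, |∑ k, c σ k * g k|) (stdGaussianPi K) :=
    (integrable_const _).add (integrable_finsetSum _ fun σ _ => (integrable_finsetSum _
      fun k _ => (integrable_eval_stdGaussianPi k).const_mul _).abs)
  refine hi.mono' ?_ (.of_forall fun g => abs_log_sum_exp_le _)
  exact ((continuous_log_sum_exp (S := S)).comp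
    (g := fun x : S → ℝ => Real.log (∑ σ, Real.exp (x σ)))
    (f := fun (g : K → ℝ) σ => ∑ k, c σ k * g k) (by fun_prop)).aestronglyMeasurable

lemma integral_eval_mul_gibbsWeight (c : S → K → ℝ) (σ : S) (k : K) :
    ∫ g, g k * gibbsWeight (fun τ => ∑ j, c τ j * g j) σ ∂stdGaussianPi K =
      ∫ g, gibbsWeight (fun τ => ∑ j, c τ j * g j) σ *
        (c σ k - ∑ τ, gibbsWeight (fun τ => ∑ j, c τ j * g j) τ * c τ k) ∂stdGaussianPi K := by
  classical
  refine integral_eval_mul_stdGaussianPi (B := 1) (B' := 1 * (|c σ k| + ∑ τ, 1 * |c τ k|)) k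
    (continuous_gibbsWeight_linear c σ) ?_ (fun g t => ?_)
    (fun g => norm_gibbsWeight_le_one _ _) fun g => ?_
  · fun_prop
  · refine hasDerivAt_gibbsWeight (x := fun t τ => ∑ j, c τ j * Function.update g k t j)
      (x' := fun τ => c τ k) (fun τ => ?_) σ
    have h := HasDerivAt.fun_sum (u := Finset.univ) fun j _ =>
      (hasDerivAt_pi.1 (hasDerivAt_update g k t) j).const_mul (c τ j)
    simpa [Pi.single_apply] using h
  · rw [norm_mul]
    gcongr
    · exact norm_gibbsWeight_le_one _ _
    · refine (norm_sub_le _ _).trans ?_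
      gcongr
      · exact le_rfl
      · refine (norm_sum_le _ _).trans (Finset.sum_le_sum fun τ _ => ?_)
        rw [norm_mul]
        gcongr
        · exact norm_gibbsWeight_le_one _ _
        · exact le_rfl

/-- Derivative of the mean free energy along the rotation of `a` into `b`. -/
lemma hasDerivAt_integral_log_sum_exp_rotation (a b : S → K → ℝ) (θ : ℝ) :
    HasDerivAt (fun θ => ∫ g, Real.log (∑ σ, Real.exp
        (∑ k, (Real.cos θ * a σ k + Real.sin θ * b σ k) * g k)) ∂stdGaussianPi K)
      (∫ g, ∑ σ, gibbsWeight
          (fun τ => ∑ k, (Real.cos θ * a τ k + Real.sin θ * b τ k) * g k) σ *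
        ∑ k, (-Real.sin θ * a σ k + Real.cos θ * b σ k) * g k ∂stdGaussianPi K) θ := by
  refine (hasDerivAt_integral_of_dominated_loc_of_deriv_le
    (F' := fun θ g => ∑ σ, gibbsWeight
          (fun τ => ∑ k, (Real.cos θ * a τ k + Real.sin θ * b τ k) * g k) σ *
        ∑ k, (-Real.sin θ * a σ k + Real.cos θ * b σ k) * g k)
    (bound := fun g => ∑ σ, ∑ k, (|a σ k| + |b σ k|) * |g k|)
    (s := Set.univ) Filter.univ_mem
    (.of_forall fun θ => (integrable_log_sum_exp_stdGaussianPi _).aestronglyMeasurable)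
    (integrable_log_sum_exp_stdGaussianPi _) ?_ (.of_forall fun g θ _ => ?_) ?_
    (.of_forall fun g θ _ => ?_)).2
  · exact Continuous.aestronglyMeasurable (by fun_prop)
  · refine (norm_sum_le _ _).trans (Finset.sum_le_sum fun σ _ => ?_)
    rw [norm_mul]
    refine (mul_le_of_le_one_left (norm_nonneg _) (norm_gibbsWeight_le_one _ _)).trans ?_
    refine (norm_sum_le _ _).trans (Finset.sum_le_sum fun k _ => ?_)
    rw [norm_mul, Real.norm_eq_abs (g k)]
    gcongr
    refine (norm_add_le _ _).trans ?_
    rw [norm_mul, norm_mul, norm_neg]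
    gcongr
    · exact mul_le_of_le_one_left (abs_nonneg _) (Real.abs_sin_le_one θ)
    · exact mul_le_of_le_one_left (abs_nonneg _) (Real.abs_cos_le_one θ)
  · exact integrable_finsetSum _ fun σ _ => integrable_finsetSum _ fun k _ =>
      (integrable_eval_stdGaussianPi k).abs.const_mul _
  · refine hasDerivAt_log_sum_exp fun σ => HasDerivAt.fun_sum fun k _ => ?_
    exact (((Real.hasDerivAt_cos θ).mul_const _).add
      ((Real.hasDerivAt_sin θ).mul_const _)).mul_const _

/-- Gaussian integration by parts for the Gibbs average of a linear form. -/
lemma integral_sum_gibbsWeight_mul (c d : S → K → ℝ) :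
    ∫ g, ∑ σ, gibbsWeight (fun τ => ∑ k, c τ k * g k) σ * ∑ k, d σ k * g k ∂stdGaussianPi K =
      ∫ g, ∑ σ, gibbsWeight (fun τ => ∑ k, c τ k * g k) σ *
        (∑ k, d σ k * c σ k - ∑ τ, gibbsWeight (fun τ => ∑ k, c τ k * g k) τ *
          ∑ k, d σ k * c τ k) ∂stdGaussianPi K := by
  have hc : ∀ σ, Continuous fun g : K → ℝ => gibbsWeight (fun τ => ∑ k, c τ k * g k) σ :=
    continuous_gibbsWeight_linear c
  have hi : ∀ σ k, Integrable (fun g : K → ℝ =>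
      g k * gibbsWeight (fun τ => ∑ k, c τ k * g k) σ) (stdGaussianPi K) := fun σ k =>
    (integrable_eval_stdGaussianPi k).mul_bdd (hc σ).aestronglyMeasurable
      (.of_forall fun g => norm_gibbsWeight_le_one _ _)
  have hw : ∀ σ, Integrable (fun g : K → ℝ =>
      gibbsWeight (fun τ => ∑ k, c τ k * g k) σ) (stdGaussianPi K) := fun σ =>
    Integrable.of_bound (hc σ).aestronglyMeasurable 1
      (.of_forall fun g => norm_gibbsWeight_le_one _ _)
  have hj : ∀ σ k, Integrable (fun g : K → ℝ =>
      gibbsWeight (fun τ => ∑ k, c τ k * g k) σ *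
        (c σ k - ∑ τ, gibbsWeight (fun τ => ∑ k, c τ k * g k) τ * c τ k))
      (stdGaussianPi K) := fun σ k =>
    Integrable.mul_bdd (c := 1)
      ((integrable_const _).sub (integrable_finsetSum _ fun τ _ => (hw τ).mul_const _))
      (hc σ).aestronglyMeasurable (.of_forall fun g => norm_gibbsWeight_le_one _ _) |>.congr
      (.of_forall fun g => mul_comm _ _)
  have h1 : ∀ g : K → ℝ,
      ∑ σ, gibbsWeight (fun τ => ∑ k, c τ k * g k) σ * ∑ k, d σ k * g k =
      ∑ σ, ∑ k, d σ k * (g k * gibbsWeight (fun τ => ∑ k, c τ k * g k) σ) := fun g => by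
    refine Finset.sum_congr rfl fun σ _ => ?_
    rw [Finset.mul_sum]
    exact Finset.sum_congr rfl fun k _ => by ring
  have h2 : ∀ g : K → ℝ,
      ∑ σ, gibbsWeight (fun τ => ∑ k, c τ k * g k) σ *
        (∑ k, d σ k * c σ k - ∑ τ, gibbsWeight (fun τ => ∑ k, c τ k * g k) τ *
          ∑ k, d σ k * c τ k) =
      ∑ σ, ∑ k, d σ k * (gibbsWeight (fun τ => ∑ k, c τ k * g k) σ *
        (c σ k - ∑ τ, gibbsWeight (fun τ => ∑ k, c τ k * g k) τ * c τ k)) := fun g => by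
    refine Finset.sum_congr rfl fun σ _ => ?_
    generalize gibbsWeight (fun τ => ∑ k, c τ k * g k) = p
    simp only [mul_sub, Finset.sum_sub_distrib, Finset.mul_sum]
    rw [Finset.sum_comm]
    congr 1
    · exact Finset.sum_congr rfl fun k _ => by ring
    · exact Finset.sum_congr rfl fun k _ => Finset.sum_congr rfl fun τ _ => by ring
  simp only [h1, h2]
  rw [integral_finsetSum _ fun σ _ => integrable_finsetSum _ fun k _ => (hi σ k).const_mul _,
    integral_finsetSum _ fun σ _ => integrable_finsetSum _ fun k _ => (hj σ k).const_mul _]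
  refine Finset.sum_congr rfl fun σ _ => ?_
  rw [integral_finsetSum _ fun k _ => (hi σ k).const_mul _,
    integral_finsetSum _ fun k _ => (hj σ k).const_mul _]
  refine Finset.sum_congr rfl fun k _ => ?_
  rw [integral_const_mul, integral_const_mul, integral_eval_mul_gibbsWeight]

/-- **Gaussian comparison** for the mean free energy of two independent centred Gaussian fields
with equal variances. -/
lemma integral_log_sum_exp_le_of_covariance_le (a b : S → K → ℝ)
    (hab : ∀ σ τ, ∑ k, a σ k * b τ k = 0)
    (hdiag : ∀ σ, ∑ k, a σ k * a σ k = ∑ k, b σ k * b σ k)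
    (hcov : ∀ σ τ, ∑ k, a σ k * a τ k ≤ ∑ k, b σ k * b τ k) :
    ∫ g, Real.log (∑ σ, Real.exp (∑ k, b σ k * g k)) ∂stdGaussianPi K ≤
      ∫ g, Real.log (∑ σ, Real.exp (∑ k, a σ k * g k)) ∂stdGaussianPi K := by
  have hd := hasDerivAt_integral_log_sum_exp_rotation a b
  have hD : ∀ θ σ τ, ∑ k, (-Real.sin θ * a σ k + Real.cos θ * b σ k) *
      (Real.cos θ * a τ k + Real.sin θ * b τ k) =
      Real.sin θ * Real.cos θ * (∑ k, b σ k * b τ k - ∑ k, a σ k * a τ k) := by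
    intro θ σ τ
    have : ∀ k, (-Real.sin θ * a σ k + Real.cos θ * b σ k) *
        (Real.cos θ * a τ k + Real.sin θ * b τ k) =
        Real.sin θ * Real.cos θ * (b σ k * b τ k) - Real.sin θ * Real.cos θ * (a σ k * a τ k)
        - Real.sin θ ^ 2 * (a σ k * b τ k) + Real.cos θ ^ 2 * (a τ k * b σ k) := fun k => by ring
    simp only [this, Finset.sum_add_distrib, Finset.sum_sub_distrib, ← Finset.mul_sum, hab]
    ring
  have hanti := antitoneOn_of_deriv_nonpos (convex_Icc 0 (Real.pi / 2))
    (f := fun θ => ∫ g, Real.log (∑ σ, Real.exp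
        (∑ k, (Real.cos θ * a σ k + Real.sin θ * b σ k) * g k)) ∂stdGaussianPi K)
    (fun θ _ => (hd θ).continuousAt.continuousWithinAt)
    (fun θ _ => (hd θ).differentiableAt.differentiableWithinAt) fun θ hθ => by
      rw [interior_Icc] at hθ
      rw [(hd θ).deriv, integral_sum_gibbsWeight_mul]
      refine integral_nonpos fun g => Finset.sum_nonpos fun σ _ =>
        mul_nonpos_of_nonneg_of_nonpos (gibbsWeight_nonneg _ _) ?_
      simp only [hD, hdiag, sub_self, mul_zero, zero_sub, neg_nonpos]
      refine Finset.sum_nonneg fun τ _ => mul_nonneg (gibbsWeight_nonneg _ _)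
        (mul_nonneg (mul_nonneg ?_ ?_) (sub_nonneg.2 (hcov σ τ)))
      · exact (Real.sin_pos_of_pos_of_lt_pi hθ.1 (by linarith [hθ.2, Real.pi_pos])).le
      · exact (Real.cos_pos_of_mem_Ioo ⟨by linarith [hθ.1, Real.pi_pos], hθ.2⟩).le
  have hpi : (0 : ℝ) ≤ Real.pi / 2 := by positivity
  simpa using hanti (Set.left_mem_Icc.2 hpi) (Set.right_mem_Icc.2 hpi) hpi

end Comparison

/-- Annealed bound on the mean free energy of a Gaussian field with constant variance. -/
lemma integral_log_sum_exp_le {S K : Type*} [Fintype S] [Nonempty S] [Fintype K]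
    (c : S → K → ℝ) {v : ℝ} (hv : ∀ σ, ∑ k, c σ k * c σ k = v) :
    ∫ g, Real.log (∑ σ, Real.exp (∑ k, c σ k * g k)) ∂stdGaussianPi K ≤
      Real.log (Fintype.card S) + v / 2 := by
  have hcard : (0 : ℝ) < Fintype.card S := by exact_mod_cast Fintype.card_pos
  have hi : ∀ σ, Integrable (fun g : K → ℝ => Real.exp (∑ k, c σ k * g k)) (stdGaussianPi K) := by
    intro σ
    simp only [Real.exp_sum]
    exact Integrable.fintype_prod (f := fun k x => Real.exp (c σ k * x))
      fun k => integrable_exp_mul_gaussianReal _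
  have hexp : ∀ σ, ∫ g : K → ℝ, Real.exp (∑ k, c σ k * g k) ∂stdGaussianPi K =
      Real.exp (v / 2) := by
    intro σ
    simp only [Real.exp_sum]
    rw [integral_fintype_prod_eq_prod (fun k x => Real.exp (c σ k * x)), ← hv σ, Finset.sum_div,
      Real.exp_sum]
    refine Finset.prod_congr rfl fun k _ => ?_
    have h := congrFun (mgf_fun_id_gaussianReal (μ := 0) (v := 1)) (c σ k)
    rw [mgf] at h
    rw [h]
    simp [sq]
  set C := Fintype.card S * Real.exp (v / 2) with hC
  have hCpos : 0 < C := by positivity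
  have hZ : ∫ g : K → ℝ, ∑ σ, Real.exp (∑ k, c σ k * g k) ∂stdGaussianPi K = C := by
    rw [integral_finsetSum _ fun σ _ => hi σ]
    simp [hexp, hC]
  have hZi : Integrable (fun g : K → ℝ => ∑ σ, Real.exp (∑ k, c σ k * g k)) (stdGaussianPi K) :=
    integrable_finsetSum _ fun σ _ => hi σ
  calc _ ≤ ∫ g : K → ℝ, ((∑ σ, Real.exp (∑ k, c σ k * g k)) / C + (Real.log C - 1))
        ∂stdGaussianPi K := by
        refine integral_mono (integrable_log_sum_exp_stdGaussianPi c)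
          ((hZi.div_const _).add (integrable_const _)) fun g => ?_
        have hp := sum_exp_pos fun σ => ∑ k, c σ k * g k
        have h := Real.log_le_sub_one_of_pos (div_pos hp hCpos)
        rw [Real.log_div hp.ne' hCpos.ne'] at h
        simp only
        linarith
    _ = Real.log C := by
        rw [integral_add (hZi.div_const _) (integrable_const _), integral_div, hZ,
          div_self hCpos.ne']
        simp
    _ = _ := by rw [hC, Real.log_mul hcard.ne' (Real.exp_pos _).ne', Real.log_exp]

/-- An array of distinct coordinates of a standard Gaussian vector has the law of the
couplings. -/
lemma measurePreserving_skCouplings {K : Type*} [Fintype K] {N : ℕ} {e : Fin N × Fin N → K}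
    (he : e.Injective) :
    MeasurePreserving (fun (g : K → ℝ) i j => g (e (i, j))) (stdGaussianPi K)
      (skCouplings N) := by
  have h1 : MeasurePreserving (fun (g : K → ℝ) p => g (e p)) (stdGaussianPi K)
      (stdGaussianPi (Fin N × Fin N)) := by
    refine ⟨by fun_prop, ?_⟩
    have h := ((iIndepFun_pi (μ := fun _ : K => gaussianReal 0 1) (X := fun _ x => x)
      fun _ => aemeasurable_id).precomp he).map_fun_eq_pi_map
        fun _ => (measurable_pi_apply _).aemeasurable
    rw [h]
    congr 1 with p : 1
    exact (measurePreserving_eval (fun _ : K => gaussianReal 0 1) (e p)).map_eq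
  have h2 : MeasurePreserving (MeasurableEquiv.curry (Fin N) (Fin N) ℝ)
      (stdGaussianPi (Fin N × Fin N)) (skCouplings N) := by
    refine ⟨MeasurableEquiv.measurable _, ?_⟩
    have h := Measure.infinitePi_map_curry (X := ℝ)
      (fun (_ : Fin N) (_ : Fin N) => gaussianReal 0 1)
    simpa only [Measure.infinitePi_eq_pi, skCouplings, stdGaussianPi] using h
  exact h2.comp h1

/-- The spin `±1` encoded by a Boolean. -/
def spin (b : Bool) : ℝ := if b then 1 else -1

lemma spin_mul_self (b : Bool) : spin b * spin b = 1 := by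
  cases b <;> simp [spin]

/-- The coefficient of the coupling `J p.1 p.2` in `-β H_N(σ)`. -/
noncomputable def skCoeff (N : ℕ) (β : ℝ) (σ : Fin N → Bool) (p : Fin N × Fin N) : ℝ :=
  β / √N * (spin (σ p.1) * spin (σ p.2))

lemma neg_mul_skH (N : ℕ) (β : ℝ) (J : Fin N → Fin N → ℝ) (σ : Fin N → Bool) :
    -β * skH N J σ = ∑ p, skCoeff N β σ p * J p.1 p.2 := by
  simp only [skH, skCoeff, spin, Fintype.sum_prod_type, Finset.mul_sum]
  exact Finset.sum_congr rfl fun i _ => Finset.sum_congr rfl fun j _ => by ring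

lemma skZ_eq (N : ℕ) (β : ℝ) (J : Fin N → Fin N → ℝ) :
    skZ N β J = ∑ σ, Real.exp (∑ p, skCoeff N β σ p * J p.1 p.2) := by
  simp only [skZ, neg_mul_skH]

lemma skZ_pos (N : ℕ) (β : ℝ) (J : Fin N → Fin N → ℝ) : 0 < skZ N β J :=
  sum_exp_pos _

lemma continuous_log_skZ (N : ℕ) (β : ℝ) : Continuous fun J => Real.log (skZ N β J) := by
  refine Continuous.log ?_ fun J => (skZ_pos N β J).ne'
  unfold skZ skH
  fun_prop

lemma sum_skCoeff_mul (N : ℕ) (β : ℝ) (σ τ : Fin N → Bool) :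
    ∑ p, skCoeff N β σ p * skCoeff N β τ p =
      β ^ 2 * ((∑ i, spin (σ i) * spin (τ i)) ^ 2 / N) := by
  have h : ∀ p, skCoeff N β σ p * skCoeff N β τ p =
      (β / √N) ^ 2 * ((spin (σ p.1) * spin (τ p.1)) * (spin (σ p.2) * spin (τ p.2))) :=
    fun p => by simp only [skCoeff]; ring
  simp only [h, ← Finset.mul_sum]
  rw [div_pow, Real.sq_sqrt N.cast_nonneg, sq (∑ i, _), Finset.sum_mul_sum,
    Fintype.sum_prod_type]
  ring

lemma sum_skCoeff_mul_self (N : ℕ) (β : ℝ) (σ : Fin N → Bool) :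
    ∑ p, skCoeff N β σ p * skCoeff N β σ p = β ^ 2 * N := by
  rw [sum_skCoeff_mul]
  simp only [spin_mul_self, Finset.sum_const, Finset.card_univ, Fintype.card_fin, nsmul_eq_mul,
    mul_one]
  rw [sq (N : ℝ), mul_self_div_self]

/-- The couplings may be read off distinct coordinates of any standard Gaussian vector. -/
lemma skAlpha_eq {K : Type*} [Fintype K] {N : ℕ} (β : ℝ) {e : Fin N × Fin N → K}
    (he : e.Injective) :
    skAlpha N β = -∫ g, Real.log (skZ N β fun i j => g (e (i, j))) ∂stdGaussianPi K := by
  have hmp := measurePreserving_skCouplings he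
  rw [skAlpha, ← hmp.map_eq, integral_map hmp.measurable.aemeasurable
    (continuous_log_skZ N β).aestronglyMeasurable]

lemma integrable_log_skZ {K : Type*} [Fintype K] {N : ℕ} (β : ℝ) {e : Fin N × Fin N → K}
    (he : e.Injective) :
    Integrable (fun g => Real.log (skZ N β fun i j => g (e (i, j)))) (stdGaussianPi K) := by
  have h := integrable_log_sum_exp_stdGaussianPi (skCoeff N β)
  have h1 := measurePreserving_skCouplings (e := id) (N := N) Function.injective_id
  have h2 := (measurePreserving_skCouplings he).integrable_comp_of_integrable
    (g := fun J => Real.log (skZ N β J)) ?_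
  · exact h2
  · rw [← h1.map_eq, integrable_map_measure (continuous_log_skZ N β).aestronglyMeasurable
      h1.measurable.aemeasurable]
    refine h.congr (.of_forall fun g => ?_)
    simp [skZ_eq]

/-- Superadditivity of `x² / N`. -/
lemma add_sq_div_add_le (x y : ℝ) {m n : ℕ} (hm : m = 0 → x = 0) (hn : n = 0 → y = 0) :
    (x + y) ^ 2 / ((m + n : ℕ) : ℝ) ≤ x ^ 2 / m + y ^ 2 / n := by
  rcases m.eq_zero_or_pos with rfl | hm'
  · simp [hm rfl]
  rcases n.eq_zero_or_pos with rfl | hn'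
  · simp [hn rfl]
  have hm0 : (0 : ℝ) < m := by exact_mod_cast hm'
  have hn0 : (0 : ℝ) < n := by exact_mod_cast hn'
  push_cast
  rw [div_add_div _ _ hm0.ne' hn0.ne', div_le_div_iff₀ (by positivity) (by positivity)]
  nlinarith [sq_nonneg (x * n - y * m)]

lemma skZ_mul_skZ (m n : ℕ) (β : ℝ) (J : Fin m → Fin m → ℝ) (J' : Fin n → Fin n → ℝ) :
    skZ m β J * skZ n β J' = ∑ σ : Fin (m + n) → Bool,
      Real.exp (∑ p, skCoeff m β (fun i => σ (i.castAdd n)) p * J p.1 p.2 +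
        ∑ p, skCoeff n β (fun i => σ (i.natAdd m)) p * J' p.1 p.2) := by
  rw [← (Fin.appendEquiv m n).sum_comp, Fintype.sum_prod_type, skZ_eq, skZ_eq,
    Finset.sum_mul_sum]
  refine Finset.sum_congr rfl fun σ _ => Finset.sum_congr rfl fun τ _ => ?_
  rw [← Real.exp_add]
  simp [Fin.appendEquiv]

/-- **Guerra–Toninelli**: the quenched free energy is subadditive in the volume. -/
lemma subadditive_skAlpha (β : ℝ) : Subadditive fun N => skAlpha N β := by
  intro m n
  let K := (Fin (m + n) × Fin (m + n)) ⊕ ((Fin m × Fin m) ⊕ (Fin n × Fin n))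
  have he : (Sum.inl : _ → K).Injective := Sum.inl_injective
  have he₁ : (Sum.inr ∘ Sum.inl : Fin m × Fin m → K).Injective :=
    Sum.inr_injective.comp Sum.inl_injective
  have he₂ : (Sum.inr ∘ Sum.inr : Fin n × Fin n → K).Injective :=
    Sum.inr_injective.comp Sum.inr_injective
  let a : (Fin (m + n) → Bool) → K → ℝ := fun σ => Sum.elim (skCoeff (m + n) β σ) 0
  let b : (Fin (m + n) → Bool) → K → ℝ := fun σ => Sum.elim 0
    (Sum.elim (skCoeff m β fun i => σ (i.castAdd n)) (skCoeff n β fun i => σ (i.natAdd m)))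
  have key := integral_log_sum_exp_le_of_covariance_le a b
    (fun σ τ => by simp [a, b, K, Fintype.sum_sum_type])
    (fun σ => by
      simp only [a, b, K, Fintype.sum_sum_type, Sum.elim_inl, Sum.elim_inr, Pi.zero_apply,
        mul_zero, Finset.sum_const_zero, add_zero, zero_add, sum_skCoeff_mul_self]
      push_cast
      ring)
    (fun σ τ => by
      simp only [a, b, K, Fintype.sum_sum_type, Sum.elim_inl, Sum.elim_inr, Pi.zero_apply,
        mul_zero, Finset.sum_const_zero, add_zero, zero_add, sum_skCoeff_mul]
      rw [← mul_add, Fin.sum_univ_add]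
      refine mul_le_mul_of_nonneg_left (add_sq_div_add_le _ _ ?_ ?_) (sq_nonneg β)
      · rintro rfl; simp
      · rintro rfl; simp)
  have hL : ∫ g, Real.log (∑ σ, Real.exp (∑ k, a σ k * g k)) ∂stdGaussianPi K =
      -skAlpha (m + n) β := by
    rw [skAlpha_eq β he, neg_neg]
    simp [skZ_eq, a, K, Fintype.sum_sum_type]
  have hR : ∫ g, Real.log (∑ σ, Real.exp (∑ k, b σ k * g k)) ∂stdGaussianPi K =
      -(skAlpha m β + skAlpha n β) := by
    rw [skAlpha_eq β he₁, skAlpha_eq β he₂, ← neg_add, neg_neg,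
      ← integral_add (integrable_log_skZ β he₁) (integrable_log_skZ β he₂)]
    congr 1 with g
    rw [← Real.log_mul (skZ_pos _ _ _).ne' (skZ_pos _ _ _).ne', skZ_mul_skZ]
    simp [b, K, Fintype.sum_sum_type]
  rw [hL, hR] at key
  exact neg_le_neg_iff.1 key

lemma neg_le_skAlpha (N : ℕ) (β : ℝ) :
    -((Real.log 2 + β ^ 2 / 2) * N) ≤ skAlpha N β := by
  have h := integral_log_sum_exp_le (skCoeff N β) (sum_skCoeff_mul_self N β)
  rw [skAlpha_eq β (e := id) Function.injective_id]
  simp only [skZ_eq, id]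
  refine neg_le_neg (h.trans_eq ?_)
  simp
  ring

/-- **Thermodynamic limit for the SK model**: for every `β > 0`, the quenched
free energy per site `α_N(β)/(βN)` converges as `N → ∞` to
`inf_{N ≥ 1} α_N(β)/(βN)`. -/
theorem sk_thermodynamic_limit (β : ℝ) (hβ : 0 < β) :
    Filter.Tendsto (fun N : ℕ => skAlpha N β / (β * N)) Filter.atTop
      (nhds (⨅ N : ℕ+, skAlpha N β / (β * N))) := by
  have hsub : Subadditive fun N => skAlpha N β / β := fun m n => by
    rw [← add_div]
    exact div_le_div_of_nonneg_right (subadditive_skAlpha β m n) hβ.le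
  have hbdd : BddBelow (Set.range fun N : ℕ => skAlpha N β / β / N) := by
    refine ⟨-((Real.log 2 + β ^ 2 / 2) / β), ?_⟩
    rintro _ ⟨N, rfl⟩
    have hlog : 0 ≤ Real.log 2 := Real.log_nonneg one_le_two
    rcases N.eq_zero_or_pos with rfl | hN
    · simp only [Nat.cast_zero, div_zero, Left.neg_nonpos_iff]
      positivity
    · have hN' : (0 : ℝ) < N := by exact_mod_cast hN
      simp only [div_div]
      rw [← neg_div, le_div_iff₀ (by positivity)]
      refine le_trans (le_of_eq ?_) (neg_le_skAlpha N β)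
      field_simp
  have hlim := hsub.tendsto_lim hbdd
  have hinf : hsub.lim = ⨅ N : ℕ+, skAlpha N β / (β * N) := by
    rw [Subadditive.lim, iInf]
    congr 1
    ext x
    simp only [Set.mem_image, Set.mem_Ici, Set.mem_range, div_div]
    exact ⟨fun ⟨n, hn, h⟩ => ⟨⟨n, hn⟩, h⟩, fun ⟨n, h⟩ => ⟨n, n.pos, h⟩⟩
  rw [hinf] at hlim
  simpa only [div_div] using hlim
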